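/- Let I ⊆ (0,∞) be an interval and let f : I → (0,∞) satisfy f(x·y / (t·x + (1−t)·y)) ≥ f(x)·f(y) / (t·f(x) + (1−t)·f(y)) for all x,y ∈ I and t ∈ [0,1]. Then for all x, y, z ∈ I: (2/3)·(1/f(2xz/(x+z)) + 1/f(2yz/(y+z)) + 1/f(2xy/(x+y))) ≤ (1/3)·(1/f(x) + 1/f(y) + 1/f(z)) + 1/f(3xyz/(xy + yz + xz)). -/

import Mathlib

/-- Popoviciu's inequality for a convex function, when two of the points lie on the same side
of the barycentre. -/
lemma ConvexOn.popoviciu_of_same_side {s : Set ℝ} {g : ℝ → ℝ} (hg : ConvexOn ℝ s g)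
    {a b c m : ℝ} (ha : a ∈ s) (hb : b ∈ s) (hc : c ∈ s) (hm : m ∈ s)
    (hm_eq : 3 * m = a + b + c) (hside : 0 ≤ (m - a) * (m - b)) :
    2 * (g ((a + b) / 2) + g ((a + c) / 2) + g ((b + c) / 2)) ≤
      g a + g b + g c + 3 * g m := by
  have hab : g ((a + b) / 2) ≤ (g a + g b) / 2 := by
    have h := hg.2 ha hb (by norm_num : (0 : ℝ) ≤ 1 / 2) (by norm_num : (0 : ℝ) ≤ 1 / 2)
      (by norm_num)
    simp only [smul_eq_mul] at h
    rw [show (a + b) / 2 = 1 / 2 * a + 1 / 2 * b by ring]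
    linarith
  obtain ⟨u, hu⟩ : ∃ u, u = m - a := ⟨_, rfl⟩
  obtain ⟨v, hv⟩ : ∃ v, v = m - b := ⟨_, rfl⟩
  rw [← hu, ← hv] at hside
  by_cases huv : u + v = 0
  · have hu0 : u = 0 := by nlinarith [sq_nonneg u]
    have hac : a = c := by linarith
    have hbc : b = c := by linarith
    have hmc : m = c := by linarith
    subst hac hbc hmc
    rw [show (m + m) / 2 = m by ring]
    linarith
  · have hw : 0 ≤ u / (u + v) ∧ 0 ≤ v / (u + v) := by
      have hsq : 0 < (u + v) ^ 2 := by positivity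
      constructor
      · rw [show u / (u + v) = (u ^ 2 + u * v) / (u + v) ^ 2 by field_simp]
        positivity
      · rw [show v / (u + v) = (v ^ 2 + u * v) / (u + v) ^ 2 by field_simp; ring]
        positivity
    have hsum : u / (u + v) + v / (u + v) = 1 := by field_simp
    have hu_mul : u / (u + v) * (u + v) = u := div_mul_cancel₀ _ huv
    have hv_mul : v / (u + v) * (u + v) = v := div_mul_cancel₀ _ huv
    generalize u / (u + v) = p at *
    generalize v / (u + v) = q at *
    have hc_eq : c = m + (u + v) := by linarith
    have hac := hg.2 hm hc (by linarith : 0 ≤ (1 + p) / 2) (by linarith : 0 ≤ q / 2)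
      (by linarith)
    have hbc := hg.2 hm hc (by linarith : 0 ≤ (1 + q) / 2) (by linarith : 0 ≤ p / 2)
      (by linarith)
    simp only [smul_eq_mul] at hac hbc
    rw [show (1 + p) / 2 * m + q / 2 * c = (a + c) / 2 by
      rw [hc_eq]; linear_combination m / 2 * hsum + hv_mul / 2 - hu / 2] at hac
    rw [show (1 + q) / 2 * m + p / 2 * c = (b + c) / 2 by
      rw [hc_eq]; linear_combination m / 2 * hsum + hu_mul / 2 - hv / 2] at hbc
    have hsm : p * g m + q * g m = g m := by rw [← add_mul, hsum, one_mul]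
    have hsc : p * g c + q * g c = g c := by rw [← add_mul, hsum, one_mul]
    linarith

/-- **Popoviciu's inequality** for convex functions. -/
lemma ConvexOn.popoviciu {s : Set ℝ} {g : ℝ → ℝ} (hg : ConvexOn ℝ s g)
    {a b c : ℝ} (ha : a ∈ s) (hb : b ∈ s) (hc : c ∈ s) :
    2 * (g ((a + b) / 2) + g ((a + c) / 2) + g ((b + c) / 2)) ≤
      g a + g b + g c + 3 * g ((a + b + c) / 3) := by
  obtain ⟨m, hm⟩ : ∃ m, m = (a + b + c) / 3 := ⟨_, rfl⟩
  have hms : m ∈ s := by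
    have h := hg.1 (hg.1 ha hb (by norm_num : (0 : ℝ) ≤ 1 / 2) (by norm_num : (0 : ℝ) ≤ 1 / 2)
      (by norm_num)) hc (by norm_num : (0 : ℝ) ≤ 2 / 3) (by norm_num : (0 : ℝ) ≤ 1 / 3)
      (by norm_num)
    simp only [smul_eq_mul] at h
    convert h using 1
    rw [hm]; ring
  rw [← hm]
  by_cases hab : 0 ≤ (m - a) * (m - b)
  · exact hg.popoviciu_of_same_side ha hb hc hms (by linarith) hab
  by_cases hac : 0 ≤ (m - a) * (m - c)
  · have h := hg.popoviciu_of_same_side ha hc hb hms (by linarith) hac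
    rw [add_comm c b] at h
    linarith
  have hbc : 0 ≤ (m - b) * (m - c) := by
    by_contra hbc
    push Not at hab hac hbc
    have := mul_pos_of_neg_of_neg hab hac
    nlinarith [sq_nonneg (m - a), mul_nonneg (sq_nonneg (m - a)) (neg_nonneg.2 hbc.le)]
  have h := hg.popoviciu_of_same_side hb hc ha hms (by linarith) hbc
  rw [add_comm b a, add_comm c a] at h
  linarith

/-- If `f` is positive and `H_tH_t`-concave on `I`, then `u ↦ 1 / f (1 / u)` is convex on the
set of reciprocals of points of `I`. -/
lemma convexOn_inv_comp_inv {I : Set ℝ} (hI : Convex ℝ I) (hI_pos : I ⊆ Set.Ioi (0 : ℝ))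
    {f : ℝ → ℝ} (hf_pos : ∀ x ∈ I, 0 < f x)
    (hf : ∀ x ∈ I, ∀ y ∈ I, ∀ t ∈ Set.Icc (0 : ℝ) 1,
      f (x * y / (t * x + (1 - t) * y)) ≥ f x * f y / (t * f x + (1 - t) * f y)) :
    ConvexOn ℝ {u : ℝ | u⁻¹ ∈ I} (fun u ↦ (f u⁻¹)⁻¹) := by
  have key : ∀ u v p q : ℝ, 0 < u → 0 < v → p + q = 1 → 0 ≤ p → 0 ≤ q →
      0 < p * u + q * v := by
    intro u v p q hu hv hpq hp hq
    rcases hp.eq_or_lt with rfl | hp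
    · have : q = 1 := by linarith
      simpa [this] using hv
    · positivity
  have hconv : Convex ℝ {u : ℝ | u⁻¹ ∈ I} := by
    rw [convex_iff_ordConnected] at hI ⊢
    refine ⟨fun u hu v hv w hw ↦ ?_⟩
    have hu0 : 0 < u := inv_pos.1 (hI_pos hu)
    have hw0 : 0 < w := hu0.trans_le hw.1
    exact hI.out hv hu ⟨inv_anti₀ hw0 hw.2, inv_anti₀ hu0 hw.1⟩
  refine ⟨hconv, fun u hu v hv p q hp hq hpq ↦ ?_⟩
  have hw : (p • u + q • v)⁻¹ ∈ I := hconv hu hv hp hq hpq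
  have hu0 : 0 < u := inv_pos.1 (hI_pos hu)
  have hv0 : 0 < v := inv_pos.1 (hI_pos hv)
  have hfu := hf_pos _ hu
  have hfv := hf_pos _ hv
  have h := hf _ hu _ hv q ⟨hq, by linarith⟩
  have hq' : 1 - q = p := by linarith
  have hden := key u v p q hu0 hv0 hpq hp hq
  have hfden := key _ _ q p hfu hfv (by linarith) hq hp
  simp only [smul_eq_mul] at hw ⊢
  rw [hq', show u⁻¹ * v⁻¹ / (q * u⁻¹ + p * v⁻¹) = (p * u + q * v)⁻¹ by
    have : q * u⁻¹ + p * v⁻¹ = (p * u + q * v) * (u⁻¹ * v⁻¹) := by field_simp; ring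
    rw [this]; field_simp] at h
  have h' := inv_anti₀ (by positivity) h
  refine h'.trans_eq ?_
  clear h h' hf hf_pos
  generalize f u⁻¹ = a at *
  generalize f v⁻¹ = b at *
  field_simp
  ring


/-- Popoviciu-type inequality for `H_tH_t`-concave functions. -/
theorem popoviciu_HH (I : Set ℝ) (hI : Convex ℝ I) (hI_pos : I ⊆ Set.Ioi (0 : ℝ))
    (f : ℝ → ℝ) (hf_pos : ∀ x ∈ I, 0 < f x)
    (hf : ∀ x ∈ I, ∀ y ∈ I, ∀ t ∈ Set.Icc (0 : ℝ) 1,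
      f (x * y / (t * x + (1 - t) * y)) ≥ f x * f y / (t * f x + (1 - t) * f y)) :
    ∀ x ∈ I, ∀ y ∈ I, ∀ z ∈ I,
      (2 / 3) * (1 / f (2 * x * z / (x + z)) + 1 / f (2 * y * z / (y + z)) +
          1 / f (2 * x * y / (x + y))) ≤
        (1 / 3) * (1 / f x + 1 / f y + 1 / f z) +
          1 / f (3 * x * y * z / (x * y + y * z + x * z)) := by
  intro x hx y hy z hz
  have hx0 : 0 < x := hI_pos hx
  have hy0 : 0 < y := hI_pos hy
  have hz0 : 0 < z := hI_pos hz
  have h := (convexOn_inv_comp_inv hI hI_pos hf_pos hf).popoviciu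
    (a := x⁻¹) (b := y⁻¹) (c := z⁻¹) (by simpa using hx) (by simpa using hy) (by simpa using hz)
  have hxy : ((x⁻¹ + y⁻¹) / 2)⁻¹ = 2 * x * y / (x + y) := by field_simp; ring
  have hxz : ((x⁻¹ + z⁻¹) / 2)⁻¹ = 2 * x * z / (x + z) := by field_simp; ring
  have hyz : ((y⁻¹ + z⁻¹) / 2)⁻¹ = 2 * y * z / (y + z) := by field_simp; ring
  have hxyz : ((x⁻¹ + y⁻¹ + z⁻¹) / 3)⁻¹ = 3 * x * y * z / (x * y + y * z + x * z) := by
    have : x⁻¹ + y⁻¹ + z⁻¹ = (x * y + y * z + x * z) / (x * y * z) := by field_simp; ring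
    rw [this]; field_simp
  simp only [hxy, hxz, hyz, hxyz, inv_inv] at h
  simp only [one_div]
  linarith
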